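/- arXiv:2602.14712 — 10 statements merged into one kernel-verified Lean document; each statement's English description precedes it below -/
import Mathlib

section
/- Let M > 0. For every r > M one has r_*(Φ(r)) = −r_*(r), where Φ is the Couch–Torrence map and r_* is the tortoise coordinate. That is, the Couch–Torrence map reverses the sign of the tortoise coordinate. -/
/-- The Couch–Torrence map `Φ(r) = M + M²/(r − M)`. -/
noncomputable def CTmap (M r : ℝ) : ℝ := M + M ^ 2 / (r - M)

/-- The tortoise coordinate `r_*(r) = r − M + M²/(M − r) + 2M·log((r − M)/M)`
of extremal Reissner–Nordström, defined for `r > M`. -/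
noncomputable def tortoise (M r : ℝ) : ℝ :=
  r - M + M ^ 2 / (M - r) + 2 * M * Real.log ((r - M) / M)

/-- The Couch–Torrence map reverses the sign of the tortoise coordinate:
`r_*(Φ(r)) = −r_*(r)` for every `r > M`. -/
theorem couch_torrence_reverses_tortoise (M : ℝ) (hM : 0 < M) :
    ∀ r : ℝ, M < r → tortoise M (CTmap M r) = - tortoise M r := by
  intro r hr
  have hx : 0 < r - M := sub_pos.mpr hr
  obtain ⟨x, rfl⟩ : ∃ x, r = M + x := ⟨r - M, by ring⟩
  have hx' : 0 < x := by linarith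
  have hM0 : M ≠ 0 := hM.ne'
  have hx0 : x ≠ 0 := hx'.ne'
  unfold tortoise CTmap
  have e1 : M + x - M = x := by ring
  have e2 : M - (M + x) = -x := by ring
  have e3 : M + M ^ 2 / x - M = M ^ 2 / x := by ring
  have e4 : M - (M + M ^ 2 / x) = -(M ^ 2 / x) := by ring
  have e5 : M ^ 2 / x / M = (x / M)⁻¹ := by field_simp
  have e6 : M ^ 2 / -(M ^ 2 / x) = -x := by field_simp
  rw [e1, e2, e3, e4, e5, e6, Real.log_inv, div_neg]
  ring
end

section
/- Let M > 0, and for r > M set Φ(r) = M + M²/(r − M), Ω(r) = M/(r − M), and D(r) = (1 − M/r)². Then for every r > M: (i) Φ(r) = Ω(r)·r; (ii) Φ'(r) = −Ω(r)²; (iii) D(Φ(r)) = Ω(r)²·D(r). (Together, these identities express that the pullback of the extremal Reissner–Nordström exterior metric −D dt² + D⁻¹dr² + r²ĝ_{S²} under (t, r, ω) ↦ (t, Φ(r), ω) equals Ω² times the metric itself.) -/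
/-- The Couch–Torrence conformal factor `Ω(r) = M/(r − M)`. -/
noncomputable def Omega (M r : ℝ) : ℝ := M / (r - M)

/-- The extremal Reissner–Nordström metric coefficient `D(r) = (1 − M/r)²`. -/
noncomputable def Dcoef (M r : ℝ) : ℝ := (1 - M / r) ^ 2

/-- For `r > M`: (i) `Φ(r) = Ω(r)·r`; (ii) `Φ'(r) = −Ω(r)²`;
(iii) `D(Φ(r)) = Ω(r)²·D(r)`.  Together these express that the pullback of the
extremal Reissner–Nordström exterior metric under `(t, r, ω) ↦ (t, Φ(r), ω)`
equals `Ω²` times the metric itself. -/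
theorem couch_torrence_conformal_identities (M : ℝ) (hM : 0 < M)
    (r : ℝ) (hr : M < r) :
    CTmap M r = Omega M r * r ∧
      HasDerivAt (CTmap M) (-(Omega M r) ^ 2) r ∧
      Dcoef M (CTmap M r) = (Omega M r) ^ 2 * Dcoef M r := by
  have h1 : r - M ≠ 0 := (sub_pos.mpr hr).ne'
  have h2 : r ≠ 0 := (hM.trans hr).ne'
  have h3 : M ≠ 0 := hM.ne'
  have key : CTmap M r = Omega M r * r := by
    unfold CTmap Omega
    field_simp
    ring
  refine ⟨key, ?_, ?_⟩
  · have h := ((hasDerivAt_const r (M ^ 2)).div ((hasDerivAt_id r).sub_const M) h1).const_add M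
    refine h.congr_deriv ?_
    simp only [Omega, id]
    field_simp
    ring
  · have h4 : M / (Omega M r * r) = (r - M) / r := by
      unfold Omega
      field_simp
    rw [key]
    unfold Dcoef
    rw [h4]
    unfold Omega
    field_simp
    ring
end

section
/- Let M > 0 and let φ : ℝ × (M, ∞) → ℝ be C². Define the conformally transformed function φ̃(t, r) = Ω(r)·φ(t, Φ(r)). Then for every (t, r) ∈ ℝ × (M, ∞), (Lφ̃)(t, r) = Ω(r)³·(Lφ)(t, Φ(r)). In particular, if Lφ = 0 then L(Ω·(φ ∘ (id × Φ))) = 0: the Couch–Torrence transformation intertwines the spherically symmetric wave operator with itself up to the conformal weight Ω³. -/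
/-- The spherically symmetric wave operator of extremal Reissner–Nordström in
static coordinates: `(Lφ)(t, r) = −D(r)⁻¹ ∂_t²φ + r⁻² ∂_r(D(r) r² ∂_rφ)`. -/
noncomputable def Lop (M : ℝ) (φ : ℝ → ℝ → ℝ) (t r : ℝ) : ℝ :=
  -(Dcoef M r)⁻¹ * deriv (fun s => deriv (fun s' => φ s' r) s) t
    + (r ^ 2)⁻¹ * deriv (fun ρ => Dcoef M ρ * ρ ^ 2 * deriv (fun ρ' => φ t ρ') ρ) r

/-- The Couch–Torrence transformation intertwines the spherically symmetric
wave operator with itself up to the conformal weight `Ω³`: for `φ` of class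
`C²` on `ℝ × (M, ∞)` and `φ̃(t, r) = Ω(r)·φ(t, Φ(r))`, one has
`(Lφ̃)(t, r) = Ω(r)³·(Lφ)(t, Φ(r))` for all `t` and all `r > M`. -/
theorem couch_torrence_intertwines_wave_operator (M : ℝ) (hM : 0 < M)
    (φ : ℝ → ℝ → ℝ)
    (hφ : ContDiffOn ℝ 2 (Function.uncurry φ) ((Set.univ : Set ℝ) ×ˢ Set.Ioi M)) :
    ∀ t r : ℝ, M < r →
      Lop M (fun t' r' => Omega M r' * φ t' (CTmap M r')) t r
        = (Omega M r) ^ 3 * Lop M φ t (CTmap M r) := by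
  intro t r hr
  have hx : 0 < r - M := sub_pos.2 hr
  have hr0 : 0 < r := hM.trans hr
  have hCT : ∀ ρ, M < ρ → M < CTmap M ρ := by
    intro ρ hρ
    have : 0 < ρ - M := sub_pos.2 hρ
    have : 0 < M ^ 2 / (ρ - M) := by positivity
    unfold CTmap
    linarith
  have hf : ContDiffOn ℝ 2 (φ t) (Set.Ioi M) := by
    have h1 : ContDiffOn ℝ 2 (fun ρ : ℝ => (t, ρ)) (Set.Ioi M) := by fun_prop
    exact hφ.comp h1 (fun ρ hρ => ⟨Set.mem_univ _, hρ⟩)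
  have hd1 : ∀ y, M < y → HasDerivAt (φ t) (deriv (φ t) y) y := fun y hy =>
    ((hf.differentiableOn (by norm_num)).differentiableAt (Ioi_mem_nhds hy)).hasDerivAt
  have hf' : ContDiffOn ℝ 1 (deriv (φ t)) (Set.Ioi M) :=
    hf.deriv_of_isOpen isOpen_Ioi (by norm_num)
  have hd2 : ∀ y, M < y → HasDerivAt (deriv (φ t)) (deriv (deriv (φ t)) y) y := fun y hy =>
    ((hf'.differentiableOn (by norm_num)).differentiableAt (Ioi_mem_nhds hy)).hasDerivAt
  have hinv : ∀ (c : ℝ) ρ, M < ρ →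
      HasDerivAt (fun ρ' => c / (ρ' - M)) (-c / (ρ - M) ^ 2) ρ := by
    intro c ρ hρ
    have h := (hasDerivAt_const ρ c).div ((hasDerivAt_id ρ).sub_const M) (sub_pos.2 hρ).ne'
    refine h.congr_deriv ?_
    simp
  have hΦ : ∀ ρ, M < ρ → HasDerivAt (CTmap M) (-M ^ 2 / (ρ - M) ^ 2) ρ := by
    intro ρ hρ
    exact (hinv (M ^ 2) ρ hρ).const_add M
  have hD : ∀ ρ, M < ρ → Dcoef M ρ * ρ ^ 2 = (ρ - M) ^ 2 := by
    intro ρ hρ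
    have : ρ ≠ 0 := (hM.trans hρ).ne'
    unfold Dcoef
    field_simp
  -- first radial derivative of the transformed function
  have hg : ∀ ρ, M < ρ → deriv (fun ρ' => Omega M ρ' * φ t (CTmap M ρ')) ρ
      = -M / (ρ - M) ^ 2 * φ t (CTmap M ρ)
        + M / (ρ - M) * (deriv (φ t) (CTmap M ρ) * (-M ^ 2 / (ρ - M) ^ 2)) := by
    intro ρ hρ
    exact ((hinv M ρ hρ).mul ((hd1 _ (hCT ρ hρ)).comp ρ (hΦ ρ hρ))).deriv
  have hL : deriv (fun ρ => Dcoef M ρ * ρ ^ 2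
        * deriv (fun ρ' => Omega M ρ' * φ t (CTmap M ρ')) ρ) r
      = 2 * M ^ 3 / (r - M) ^ 2 * deriv (φ t) (CTmap M r)
        + M ^ 5 / (r - M) ^ 3 * deriv (deriv (φ t)) (CTmap M r) := by
    have he : (fun ρ => Dcoef M ρ * ρ ^ 2
        * deriv (fun ρ' => Omega M ρ' * φ t (CTmap M ρ')) ρ)
        =ᶠ[nhds r] fun ρ => -M * φ t (CTmap M ρ)
          + -M ^ 3 / (ρ - M) * deriv (φ t) (CTmap M ρ) := by
      filter_upwards [Ioi_mem_nhds hr] with ρ hρ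
      have hρ' : ρ - M ≠ 0 := (sub_pos.2 hρ).ne'
      rw [hD ρ hρ, hg ρ hρ]
      field_simp
    rw [he.deriv_eq]
    have h := (((hd1 _ (hCT r hr)).comp r (hΦ r hr)).const_mul (-M)).add
      ((hinv (-M ^ 3) r hr).mul ((hd2 _ (hCT r hr)).comp r (hΦ r hr)))
    refine h.deriv.trans ?_
    simp only [Function.comp]
    have := hx.ne'
    field_simp
    ring
  have hR : deriv (fun ρ => Dcoef M ρ * ρ ^ 2 * deriv (φ t) ρ) (CTmap M r)
      = 2 * (CTmap M r - M) * deriv (φ t) (CTmap M r)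
        + (CTmap M r - M) ^ 2 * deriv (deriv (φ t)) (CTmap M r) := by
    have he : (fun ρ => Dcoef M ρ * ρ ^ 2 * deriv (φ t) ρ)
        =ᶠ[nhds (CTmap M r)] fun ρ => (ρ - M) ^ 2 * deriv (φ t) ρ := by
      filter_upwards [Ioi_mem_nhds (hCT r hr)] with ρ hρ
      rw [hD ρ hρ]
    rw [he.deriv_eq]
    have h := ((((hasDerivAt_id (CTmap M r)).sub_const M).pow 2).mul (hd2 _ (hCT r hr)))
    refine h.deriv.trans ?_
    simp
  have hT : deriv (fun s => deriv (fun s' => Omega M r * φ s' (CTmap M r)) s) t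
      = Omega M r * deriv (fun s => deriv (fun s' => φ s' (CTmap M r)) s) t := by
    simp only [deriv_const_mul_field]
  unfold Lop
  simp only []
  rw [hT, hL, hR]
  generalize deriv (fun s => deriv (fun s' => φ s' (CTmap M r)) s) t = A
  generalize deriv (deriv (φ t)) (CTmap M r) = B
  generalize deriv (φ t) (CTmap M r) = C
  have hx' := hx.ne'
  have hr' := hr0.ne'
  have hM' := hM.ne'
  have e1 : CTmap M r = M * r / (r - M) := by
    unfold CTmap
    field_simp
    ring
  have e2 : CTmap M r - M = M ^ 2 / (r - M) := by
    unfold CTmap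
    ring
  have e3 : Dcoef M r = (r - M) ^ 2 / r ^ 2 := by
    unfold Dcoef
    field_simp
  have e4 : Dcoef M (CTmap M r) = M ^ 2 / r ^ 2 := by
    unfold Dcoef
    rw [e1]
    field_simp
    ring
  rw [e4, e3, e2, e1]
  unfold Omega
  field_simp
  try ring
end

section
/- Let M > 0 and define the potential V(r) = D(r)·D'(r)/r for r > M, where D(r) = (1 − M/r)². Then V(r) = 2M(r − M)³/r⁶ for all r > M, and V is invariant under the Couch–Torrence map: V(Φ(r)) = V(r) for every r > M. (Consequently the 1+1–dimensional reduction (−∂_t² + ∂_{r_*}²)ψ = V ψ of the spherically symmetric extremal Reissner–Nordström wave equation, with ψ = rφ, has an even potential in the tortoise coordinate r_*.) -/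
/-- The potential `V(r) = D(r)·D'(r)/r` of the 1+1–dimensional reduction of the
spherically symmetric extremal Reissner–Nordström wave equation. -/
noncomputable def Vpot (M r : ℝ) : ℝ := Dcoef M r * deriv (Dcoef M) r / r

theorem Vpot_formula_aux (M : ℝ) (hM : 0 < M) (r : ℝ) (h : M < r) :
    Vpot M r = 2 * M * (r - M) ^ 3 / r ^ 6 := by
  have hr : r ≠ 0 := by linarith
  have h1 : HasDerivAt (fun x : ℝ => 1 - M * x⁻¹) (-(M * (-(r ^ 2)⁻¹))) r :=
    ((hasDerivAt_inv hr).const_mul M).const_sub 1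
  have h2 : HasDerivAt (Dcoef M) (2 * (1 - M * r⁻¹) * (-(M * (-(r ^ 2)⁻¹)))) r := by
    have h3 := h1.pow 2
    have e : Dcoef M = (fun x : ℝ => 1 - M * x⁻¹) ^ 2 := by
      funext x
      simp [Dcoef, div_eq_mul_inv]
    rw [e]
    have e3 : 2 * (1 - M * r⁻¹) * (-(M * (-(r ^ 2)⁻¹))) =
        ((2 : ℕ) : ℝ) * (1 - M * r⁻¹) ^ (2 - 1) * (-(M * (-(r ^ 2)⁻¹))) := by
      norm_num
    rw [e3]
    exact h3
  unfold Vpot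
  rw [h2.deriv]
  unfold Dcoef
  field_simp

/-- For `r > M`, the potential satisfies `V(r) = 2M(r − M)³/r⁶` and is
invariant under the Couch–Torrence map: `V(Φ(r)) = V(r)`. -/
theorem potential_formula_and_couch_torrence_invariance (M : ℝ) (hM : 0 < M) :
    ∀ r : ℝ, M < r →
      Vpot M r = 2 * M * (r - M) ^ 3 / r ^ 6 ∧
        Vpot M (CTmap M r) = Vpot M r := by
  intro r h
  have hr : r ≠ 0 := by linarith
  have hd : 0 < r - M := by linarith
  have hΦ : M < CTmap M r := by
    unfold CTmap
    have : 0 < M ^ 2 / (r - M) := by positivity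
    linarith
  refine ⟨Vpot_formula_aux M hM r h, ?_⟩
  rw [Vpot_formula_aux M hM _ hΦ, Vpot_formula_aux M hM r h]
  have e1 : CTmap M r - M = M ^ 2 / (r - M) := by
    unfold CTmap
    ring
  have e2 : CTmap M r = M * r / (r - M) := by
    unfold CTmap
    field_simp
    ring
  rw [e1, e2]
  have hd' := hd.ne'
  have hM' := hM.ne'
  field_simp
end

section
/- Let φ₁(v, ζ) = 2/(v(ζv + 2)), defined on the set {(v, ζ) : v > 0, ζv + 2 > 0}. Then: (i) φ₁ solves the spherically symmetric near-horizon wave equation, 2∂_v∂_ζφ₁ + ∂_ζ(ζ²∂_ζφ₁) = 0, everywhere on this set; (ii) its trace on the horizon ζ = 0 is φ₁(v, 0) = 1/v; (iii) its transversal derivative on the horizon is ∂_ζφ₁(v, 0) = −1/2 for every v > 0, a nonzero constant (a nonvanishing Aretakis-type quantity despite the inverse-polynomially decaying horizon data). -/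
/-- The spherically symmetric near-horizon wave operator of extremal
Reissner–Nordström in ingoing coordinates `(v, ζ)` (with `ζ = r − M`):
`(L_near φ)(v, ζ) = 2∂_v∂_ζφ + ∂_ζ(ζ² ∂_ζφ)`. -/
noncomputable def Lnear (φ : ℝ → ℝ → ℝ) (v ζ : ℝ) : ℝ :=
  2 * deriv (fun v' => deriv (fun z => φ v' z) ζ) v
    + deriv (fun z => z ^ 2 * deriv (fun z' => φ v z') z) ζ

/-- The explicit near-horizon solution `φ₁(v, ζ) = 2/(v(ζv + 2))`. -/
noncomputable def phiOne : ℝ → ℝ → ℝ := fun v ζ => 2 / (v * (ζ * v + 2))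

theorem phiOne_dz (v ζ : ℝ) (hv : 0 < v) (h : 0 < ζ * v + 2) :
    deriv (fun z => phiOne v z) ζ = -2 / (ζ * v + 2) ^ 2 := by
  have h1 : HasDerivAt (fun z : ℝ => v * (z * v + 2)) (v * (1 * v)) ζ :=
    (((hasDerivAt_id ζ).mul_const v).add_const 2).const_mul v
  have h2 := (hasDerivAt_const ζ (2 : ℝ)).fun_div h1 (mul_pos hv h).ne'
  have h3 := h2.deriv
  unfold phiOne
  rw [h3]
  have := hv.ne'
  have := h.ne'
  field_simp
  ring

/-- On `{v > 0, ζv + 2 > 0}`: (i) `φ₁` solves the near-horizon wave equation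
`L_near φ₁ = 0`; (ii) its trace on the horizon `ζ = 0` is `1/v`; (iii) its
transversal derivative on the horizon is the nonzero constant `−1/2`
(a nonvanishing Aretakis-type quantity despite the inverse-polynomially
decaying horizon data). -/
theorem near_horizon_solution_nonzero_aretakis :
    (∀ v ζ : ℝ, 0 < v → 0 < ζ * v + 2 → Lnear phiOne v ζ = 0) ∧
      (∀ v : ℝ, 0 < v → phiOne v 0 = 1 / v) ∧
      (∀ v : ℝ, 0 < v → deriv (fun z => phiOne v z) 0 = -(1 / 2)) := by
  refine ⟨?_, ?_, ?_⟩
  · intro v ζ hv h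
    have hne := h.ne'
    unfold Lnear
    have e1 : (fun v' => deriv (fun z => phiOne v' z) ζ) =ᶠ[nhds v]
        fun v' => -2 / (ζ * v' + 2) ^ 2 := by
      have c : Continuous fun v' : ℝ => ζ * v' + 2 := by fun_prop
      filter_upwards [lt_mem_nhds hv, c.continuousAt.eventually (lt_mem_nhds h)] with x hx hx2
      exact phiOne_dz x ζ hx hx2
    have e2 : (fun z => z ^ 2 * deriv (fun z' => phiOne v z') z) =ᶠ[nhds ζ]
        fun z => z ^ 2 * (-2 / (z * v + 2) ^ 2) := by
      have c : Continuous fun z : ℝ => z * v + 2 := by fun_prop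
      filter_upwards [c.continuousAt.eventually (lt_mem_nhds h)] with x hx2
      rw [phiOne_dz v x hv hx2]
    rw [e1.deriv_eq, e2.deriv_eq]
    have a1 : HasDerivAt (fun x : ℝ => (ζ * x + 2) ^ 2) _ v :=
      (((hasDerivAt_id v).const_mul ζ).add_const 2).fun_pow 2
    have a2 := (hasDerivAt_const v (-2 : ℝ)).fun_div a1 (pow_ne_zero 2 hne)
    have b1 : HasDerivAt (fun z : ℝ => (z * v + 2) ^ 2) _ ζ :=
      (((hasDerivAt_id ζ).mul_const v).add_const 2).fun_pow 2
    have b2 := (hasDerivAt_pow 2 ζ).fun_mul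
      ((hasDerivAt_const ζ (-2 : ℝ)).fun_div b1 (pow_ne_zero 2 hne))
    rw [a2.deriv, b2.deriv]
    simp only [id]
    push_cast
    field_simp
    ring
  · intro v hv
    unfold phiOne
    have := hv.ne'
    field_simp
    ring
  · intro v hv
    rw [phiOne_dz v 0 hv (by norm_num)]
    norm_num
end

section
/- Let p > 0 and define ψ(𝔯) = 𝔯^{p−1}(𝔯 + 2)^{−(p+1)} for 𝔯 > 0. Then: (i) ψ solves the self-similar near-horizon ODE (d/d𝔯)(𝔯(𝔯 + 2) ψ(𝔯)) = 2p ψ(𝔯) on (0, ∞); (ii) if p is a positive integer, ψ extends to a real-analytic function on (−2, ∞); (iii) if p > 1 and p is not an integer, ψ extends continuously to [0, ∞) but the extension is not of class C^{⌊p⌋} on any interval [0, ε) with ε > 0. -/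
/-- The self-similar near-horizon profile `ψ(𝔯) = 𝔯^(p−1)(𝔯 + 2)^(−(p+1))`. -/
noncomputable def psiProfile (p : ℝ) : ℝ → ℝ :=
  fun r => r ^ (p - 1) * (r + 2) ^ (-(p + 1))

lemma rpow_not_contDiff_aux (n : ℕ) : ∀ (q : ℝ) (f : ℝ → ℝ) (ε : ℝ), 0 < ε →
    (n : ℝ) - 1 < q → q < n → (∀ x ∈ Set.Ioo 0 ε, f x = x ^ q) →
    ¬ ContDiffOn ℝ (n : WithTop ℕ∞) f (Set.Ico 0 ε) := by
  induction n with
  | zero =>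
    intro q f ε hε h1 h2 hf hc
    have hq : q < 0 := by simpa using h2
    have hcont := hc.continuousOn 0 ⟨le_refl _, hε⟩
    have t1 : Filter.Tendsto f (nhdsWithin 0 (Set.Ioo 0 ε)) (nhds (f 0)) :=
      hcont.mono_left (nhdsWithin_mono _ Set.Ioo_subset_Ico_self)
    rw [nhdsWithin_Ioo_eq_nhdsGT hε] at t1
    have t2 : Filter.Tendsto f (nhdsWithin 0 (Set.Ioi 0)) Filter.atTop := by
      refine (tendsto_rpow_neg_nhdsGT_zero hq).congr' ?_
      filter_upwards [Ioo_mem_nhdsGT hε] with x hx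
      exact (hf x hx).symm
    exact not_tendsto_nhds_of_tendsto_atTop t2 _ t1
  | succ n ih =>
    intro q f ε hε h1 h2 hf hc
    push_cast at h1 h2 hc
    have hq : 0 < q := by have : (0:ℝ) ≤ n := n.cast_nonneg; linarith
    have hd := ((contDiffOn_succ_iff_derivWithin (uniqueDiffOn_Ico 0 ε)).1 hc).2.2
    refine ih (q - 1) (fun x => q⁻¹ * derivWithin f (Set.Ico 0 ε) x) ε hε (by linarith)
      (by linarith) ?_ (contDiffOn_const.mul hd)
    intro x hx
    have hm : Set.Ico 0 ε ∈ nhds x := Ico_mem_nhds hx.1 hx.2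
    have he : f =ᶠ[nhds x] fun y => y ^ q := by
      filter_upwards [Ioo_mem_nhds hx.1 hx.2] with y hy using hf y hy
    show q⁻¹ * derivWithin f (Set.Ico 0 ε) x = _
    rw [derivWithin_of_mem_nhds hm, he.deriv_eq,
      (Real.hasDerivAt_rpow_const (Or.inl hx.1.ne')).deriv]
    field_simp

/-- For `p > 0` and `ψ(𝔯) = 𝔯^(p−1)(𝔯+2)^(−(p+1))` on `(0, ∞)`:
(i) `ψ` solves the self-similar near-horizon ODE
    `(d/d𝔯)(𝔯(𝔯 + 2)ψ(𝔯)) = 2p ψ(𝔯)` on `(0, ∞)`;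
(ii) if `p` is a positive integer, `ψ` extends to a real-analytic function on
     `(−2, ∞)`;
(iii) if `p > 1` and `p` is not an integer, `ψ` extends continuously to
      `[0, ∞)` but the extension is not of class `C^⌊p⌋` on any interval
      `[0, ε)` with `ε > 0`. -/
theorem selfsimilar_profile_ode_and_regularity (p : ℝ) (hp : 0 < p) :
    (∀ r : ℝ, 0 < r →
      deriv (fun s => s * (s + 2) * psiProfile p s) r = 2 * p * psiProfile p r) ∧
    ((∃ n : ℕ, 0 < n ∧ p = n) →
      ∃ F : ℝ → ℝ, AnalyticOnNhd ℝ F (Set.Ioi (-2)) ∧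
        ∀ r : ℝ, 0 < r → F r = psiProfile p r) ∧
    ((1 < p ∧ ∀ n : ℤ, p ≠ (n : ℝ)) →
      ∃ F : ℝ → ℝ, ContinuousOn F (Set.Ici 0) ∧
        (∀ r : ℝ, 0 < r → F r = psiProfile p r) ∧
        ∀ ε : ℝ, 0 < ε → ¬ ContDiffOn ℝ (⌊p⌋₊ : ℕ∞) F (Set.Ico 0 ε)) := by
  refine ⟨?_, ?_, ?_⟩
  · intro r hr
    have he : (fun s => s * (s + 2) * psiProfile p s) =ᶠ[nhds r]
        fun s => s ^ p * (s + 2) ^ (-p) := by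
      filter_upwards [Ioi_mem_nhds hr] with s hs
      have hs : 0 < s := hs
      have hs2 : 0 < s + 2 := by linarith
      have e1 : s ^ p = s ^ (p - 1) * s := by
        rw [Real.rpow_sub_one hs.ne']; field_simp
      have e2 : (s + 2) ^ (-p) = (s + 2) ^ (-(p + 1)) * (s + 2) := by
        rw [show -(p + 1) = -p - 1 by ring, Real.rpow_sub_one hs2.ne']; field_simp
      rw [e1, e2, psiProfile]; ring
    have hr2 : 0 < r + 2 := by linarith
    have d1 := Real.hasDerivAt_rpow_const (x := r) (p := p) (Or.inl hr.ne')
    have d2 := ((hasDerivAt_id r).add_const (2:ℝ)).rpow_const (p := -p) (Or.inl hr2.ne')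
    have d := d1.mul d2
    rw [he.deriv_eq]
    refine (HasDerivAt.deriv d).trans ?_
    have e1 : r ^ p = r ^ (p - 1) * r := by
      rw [Real.rpow_sub_one hr.ne']; field_simp
    have e2 : (r + 2) ^ (-p) = (r + 2) ^ (-(p + 1)) * (r + 2) := by
      rw [show -(p + 1) = -p - 1 by ring, Real.rpow_sub_one hr2.ne']; field_simp
    simp only [id, psiProfile]
    rw [e1, e2, show -p - 1 = -(p + 1) by ring]
    ring
  · rintro ⟨n, hn, rfl⟩
    obtain ⟨m, rfl⟩ : ∃ m, n = m + 1 := ⟨n - 1, by omega⟩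
    refine ⟨fun r => r ^ m * ((r + 2) ^ (m + 2))⁻¹, ?_, ?_⟩
    · intro x hx
      have hx : -2 < x := hx
      have h2 : AnalyticAt ℝ (fun r : ℝ => (r + 2) ^ (m + 2)) x :=
        (analyticAt_id.add analyticAt_const).pow _
      exact (analyticAt_id.pow m).mul (h2.inv (pow_ne_zero _ (by linarith)))
    · intro r hr
      have hr2 : 0 < r + 2 := by linarith
      simp only [psiProfile]
      rw [Real.rpow_neg hr2.le,
        show (((m + 1 : ℕ) : ℝ) - 1) = (m : ℕ) by push_cast; ring,
        show (((m + 1 : ℕ) : ℝ) + 1) = ((m + 2 : ℕ) : ℝ) by push_cast; ring,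
        Real.rpow_natCast, Real.rpow_natCast]
  · rintro ⟨h1, hni⟩
    refine ⟨psiProfile p, ?_, fun _ _ => rfl, ?_⟩
    · intro x hx
      have hx : 0 ≤ x := hx
      have c1 : ContinuousAt (fun r : ℝ => r ^ (p - 1)) x :=
        Real.continuousAt_rpow_const _ _ (Or.inr (by linarith))
      have c2 : ContinuousAt (fun r : ℝ => (r + 2) ^ (-(p + 1))) x :=
        (continuousAt_id.add continuousAt_const).rpow_const (Or.inl (by simp; linarith))
      exact (c1.mul c2).continuousWithinAt
    · intro ε hε hc
      have hfl : (⌊p⌋₊ : ℝ) < p :=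
        lt_of_le_of_ne (Nat.floor_le hp.le) (fun h => hni (⌊p⌋₊ : ℤ) (by push_cast; exact h.symm))
      have hfl2 := Nat.lt_floor_add_one p
      have hs : ContDiffOn ℝ (⌊p⌋₊ : WithTop ℕ∞) (fun r : ℝ => (r + 2) ^ (p + 1))
          (Set.Ico 0 ε) := by
        refine ContDiffOn.rpow_const_of_ne (contDiffOn_id.add contDiffOn_const) ?_
        intro x hx
        have := hx.1
        simp; linarith
      refine rpow_not_contDiff_aux ⌊p⌋₊ (p - 1)
        (fun r => psiProfile p r * (r + 2) ^ (p + 1)) ε hε (by linarith) (by linarith) ?_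
        (ContDiffOn.mul hc hs)
      intro x hx
      have hx2 : 0 < x + 2 := by linarith [hx.1]
      simp only [psiProfile]
      rw [mul_assoc, ← Real.rpow_add hx2]
      simp
end

section
/- Let b > −1. There exists a constant C > 0 depending only on b such that for all 0 < r₁ < r₂ with r₂ ≥ 2r₁ and every C¹ function φ : [r₁, r₂] → ℝ: ∫_{r₁}^{r₂} r^b φ(r)² dr ≤ C ( ∫_{r₁}^{r₂} r^{b+2} φ'(r)² dr + ∫_{r₂/2}^{r₂} r^b φ(r)² dr ). In particular the constant is independent of r₂ (and of r₁). -/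
open MeasureTheory

lemma wp_pick (b : ℝ) (hb : -1 < b) :
    ∃ m : ℕ, (b + 1 + ((m + 1 : ℕ) : ℝ)) * (1 / 2 : ℝ) ^ (m + 1) ≤ (b + 1) / 2 := by
  have h1 := tendsto_self_mul_const_pow_of_lt_one (r := (1 / 2 : ℝ)) (by norm_num) (by norm_num)
  have h2 := (tendsto_pow_atTop_nhds_zero_of_lt_one (r := (1 / 2 : ℝ)) (by norm_num)
    (by norm_num)).const_mul (b + 1)
  have h3 := h2.add h1
  have h4 := h3.comp (Filter.tendsto_add_atTop_nat 1)
  have h5 : (b + 1) * 0 + 0 < (b + 1) / 2 := by linarith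
  obtain ⟨m, hm⟩ := (h4.eventually (gt_mem_nhds h5)).exists
  refine ⟨m, ?_⟩
  simp only [Function.comp] at hm
  rw [add_mul]
  exact hm.le

lemma wp_deriv (b r₂ r : ℝ) (hr : 0 < r) (m : ℕ) :
    HasDerivAt (fun r : ℝ => r ^ (b + 1) * (1 - (r / r₂) ^ (m + 1)))
      (r ^ b * ((b + 1) - (b + 1 + ((m + 1 : ℕ) : ℝ)) * (r / r₂) ^ (m + 1))) r := by
  have h1 : HasDerivAt (fun r : ℝ => r ^ (b + 1)) ((b + 1) * r ^ (b + 1 - 1)) r :=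
    Real.hasDerivAt_rpow_const (Or.inl hr.ne')
  have h2 := (((hasDerivAt_id r).div_const r₂).pow (m + 1)).const_sub 1
  have h3 := h1.mul h2
  refine h3.congr_deriv ?_
  have : r ^ (b + 1) = r ^ b * r := Real.rpow_add_one hr.ne' b
  simp only [add_sub_cancel_right, this, id, Pi.pow_apply]
  push_cast
  ring

lemma wp_pt (c n p r t x y L : ℝ) (hc : 0 < c) (hp : 0 ≤ p) (ht0 : 0 ≤ t)
    (ht1 : t ≤ 1) (hD : c - L ≤ 2 * c - (2 * c + n) * t) :
    c / 2 * (p * x ^ 2) - 2 / c * (p * r ^ 2 * y ^ 2) - L * (p * x ^ 2)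
      ≤ p * (2 * c - (2 * c + n) * t) * x ^ 2 + p * r * (1 - t) * (2 * x * y) := by
  have h1 : 0 ≤ p * x ^ 2 * ((2 * c - (2 * c + n) * t) - (c - L)) :=
    mul_nonneg (by positivity) (by linarith)
  have h2 : 0 ≤ c / 2 * x ^ 2 + 2 / c * (r * y) ^ 2 + (1 - t) * (2 * x * (r * y)) := by
    have h3 : c / 2 * x ^ 2 + 2 / c * (r * y) ^ 2 + (1 - t) * (2 * x * (r * y))
       = c / 2 * (x + 2 / c * (1 - t) * (r * y)) ^ 2 + 2 / c * (r * y) ^ 2 * (t * (2 - t)) := by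
      field_simp
      ring
    rw [h3]
    have : 0 ≤ t * (2 - t) := mul_nonneg ht0 (by linarith)
    positivity
  have h4 := mul_nonneg hp h2
  nlinarith [h1, h4]

/-- Weighted Poincaré inequality with averaged outer boundary term: for
`b > −1` there is a constant `C > 0` depending only on `b` such that for all
`0 < r₁ < r₂` with `r₂ ≥ 2r₁` and every `C¹` function `φ` on `[r₁, r₂]`,
`∫_{r₁}^{r₂} r^b φ² dr
  ≤ C (∫_{r₁}^{r₂} r^(b+2) φ'² dr + ∫_{r₂/2}^{r₂} r^b φ² dr)`,
with `C` independent of `r₁` and `r₂`. -/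
theorem weighted_poincare_with_outer_average (b : ℝ) (hb : -1 < b) :
    ∃ C : ℝ, 0 < C ∧
      ∀ r₁ r₂ : ℝ, 0 < r₁ → r₁ < r₂ → 2 * r₁ ≤ r₂ →
        ∀ φ : ℝ → ℝ, ContDiffOn ℝ 1 φ (Set.Icc r₁ r₂) →
          ∫ r in Set.Ioo r₁ r₂, r ^ b * (φ r) ^ 2
            ≤ C * ((∫ r in Set.Ioo r₁ r₂, r ^ (b + 2) * (deriv φ r) ^ 2)
                + ∫ r in Set.Ioo (r₂ / 2) r₂, r ^ b * (φ r) ^ 2) := by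
  obtain ⟨m, hm⟩ := wp_pick b hb
  set n : ℝ := ((m + 1 : ℕ) : ℝ) with hn
  have hn0 : 0 ≤ n := Nat.cast_nonneg _
  obtain ⟨c, hc⟩ : ∃ c, c = (b + 1) / 2 := ⟨_, rfl⟩
  have hc0 : 0 < c := by rw [hc]; linarith
  have hbc : b + 1 = 2 * c := by rw [hc]; ring
  refine ⟨2 / c * (2 / c + (c + n)), by positivity, ?_⟩
  intro r₁ r₂ h0 h12 h21 φ hφ
  have hr2 : 0 < r₂ := h0.trans h12
  set ψ := derivWithin φ (Set.Icc r₁ r₂) with hψ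
  have hψc : ContinuousOn ψ (Set.Icc r₁ r₂) :=
    hφ.continuousOn_derivWithin (uniqueDiffOn_Icc h12) le_rfl
  have hφc := hφ.continuousOn
  have hφd : ∀ r ∈ Set.Ioo r₁ r₂, HasDerivAt φ (ψ r) r := by
    intro r hr
    have := ((hφ.differentiableOn (by norm_num)) r (Set.Ioo_subset_Icc_self hr)).hasDerivWithinAt
    exact this.hasDerivAt (Icc_mem_nhds hr.1 hr.2)
  have hrp : ∀ a : ℝ, ContinuousOn (fun r : ℝ => r ^ a) (Set.Icc r₁ r₂) := fun a =>
    continuousOn_id.rpow_const (fun r hr => Or.inl (h0.trans_le hr.1).ne')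
  have hint : ∀ f : ℝ → ℝ, ContinuousOn f (Set.Icc r₁ r₂) →
      IntegrableOn f (Set.Ioo r₁ r₂) := fun f hf =>
    (hf.integrableOn_Icc).mono_set Set.Ioo_subset_Icc_self
  have e1 : ∫ r in Set.Ioo r₁ r₂, r ^ (b + 2) * (deriv φ r) ^ 2
      = ∫ r in Set.Ioo r₁ r₂, r ^ (b + 2) * (ψ r) ^ 2 := by
    apply setIntegral_congr_fun measurableSet_Ioo
    intro r hr
    simp only [(hφd r hr).deriv]
  rw [e1]
  have e2 : ∫ r in Set.Ioo (r₂ / 2) r₂, r ^ b * (φ r) ^ 2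
      = ∫ r in Set.Ioo r₁ r₂, (Set.Ioi (r₂ / 2)).indicator (fun r => r ^ b * (φ r) ^ 2) r := by
    rw [setIntegral_indicator measurableSet_Ioi]
    congr 2
    ext r
    simp only [Set.mem_inter_iff, Set.mem_Ioo, Set.mem_Ioi]
    constructor
    · rintro ⟨h1, h2⟩
      exact ⟨⟨by linarith, h2⟩, h1⟩
    · rintro ⟨⟨h1, h2⟩, h3⟩
      exact ⟨h3, h2⟩
  rw [e2]
  have i1 := hint (fun r => r ^ b * (φ r) ^ 2) ((hrp b).mul (hφc.pow 2))
  have i2 := hint (fun r => r ^ (b + 2) * (ψ r) ^ 2) ((hrp _).mul (hψc.pow 2))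
  have i3 : IntegrableOn ((Set.Ioi (r₂ / 2)).indicator (fun r => r ^ b * (φ r) ^ 2))
      (Set.Ioo r₁ r₂) := IntegrableOn.indicator i1 measurableSet_Ioi
  set g : ℝ → ℝ := fun r => r ^ (b + 1) * (1 - (r / r₂) ^ (m + 1)) with hg
  set D : ℝ → ℝ := fun r => r ^ b * ((b + 1) - (b + 1 + n) * (r / r₂) ^ (m + 1)) with hD
  have hgc : ContinuousOn g (Set.Icc r₁ r₂) := (hrp _).mul (by fun_prop)
  have hDc : ContinuousOn D (Set.Icc r₁ r₂) := (hrp _).mul (by fun_prop)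
  set G : ℝ → ℝ := fun r => D r * (φ r) ^ 2 + g r * (2 * φ r * ψ r) with hG
  have hGc : ContinuousOn G (Set.Icc r₁ r₂) :=
    (hDc.mul (hφc.pow 2)).add (hgc.mul ((continuousOn_const.mul hφc).mul hψc))
  have i4 := hint G hGc
  have ftc : ∫ r in r₁..r₂, G r = g r₂ * (φ r₂) ^ 2 - g r₁ * (φ r₁) ^ 2 := by
    apply intervalIntegral.integral_eq_sub_of_hasDerivAt_of_le h12.le
      (f := fun r => g r * (φ r) ^ 2) (hgc.mul (hφc.pow 2))
    · intro r hr
      have h1 := wp_deriv b r₂ r (h0.trans hr.1) m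
      refine (h1.mul ((hφd r hr).pow 2)).congr_deriv ?_
      simp only [hG, hD, hg, hn, Pi.pow_apply]
      push_cast
      ring
    · exact hGc.intervalIntegrable_of_Icc h12.le
  rw [intervalIntegral.integral_of_le h12.le, integral_Ioc_eq_integral_Ioo] at ftc
  have hg2 : g r₂ = 0 := by simp [hg, div_self hr2.ne']
  have hg1 : 0 ≤ g r₁ := by
    have : (r₁ / r₂) ^ (m + 1) ≤ 1 := pow_le_one₀ (by positivity) ((div_le_one hr2).2 h12.le)
    exact mul_nonneg (Real.rpow_nonneg h0.le _) (by linarith)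
  have hneg : ∫ r in Set.Ioo r₁ r₂, G r ≤ 0 := by
    rw [ftc, hg2]
    nlinarith [mul_nonneg hg1 (sq_nonneg (φ r₁))]
  have key := setIntegral_mono_on
    (((i1.const_mul (c / 2)).sub (i2.const_mul (2 / c))).sub (i3.const_mul (c + n))) i4
    measurableSet_Ioo (by
      intro r hr
      have hr0 : 0 < r := h0.trans hr.1
      have ht0 : 0 ≤ (r / r₂) ^ (m + 1) := by positivity
      have ht1 : (r / r₂) ^ (m + 1) ≤ 1 :=
        pow_le_one₀ (by positivity) ((div_le_one hr2).2 hr.2.le)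
      have q1 : r ^ (b + 1) = r ^ b * r := Real.rpow_add_one hr0.ne' b
      have q2 : r ^ (b + 2) = r ^ b * r ^ 2 := by
        rw [Real.rpow_add hr0]; norm_num
      simp only [Pi.sub_apply, hG, hD, hg, q1, q2]
      simp only [hbc]
      by_cases hh : r₂ / 2 < r
      · rw [Set.indicator_of_mem (show r ∈ Set.Ioi (r₂ / 2) from hh)]
        have h6 : c - (c + n) ≤ 2 * c - (2 * c + n) * (r / r₂) ^ (m + 1) := by nlinarith
        have := wp_pt c n (r ^ b) r _ (φ r) (ψ r) (c + n) hc0 (Real.rpow_nonneg hr0.le _) ht0 ht1 h6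
        exact this
      · rw [Set.indicator_of_notMem (show r ∉ Set.Ioi (r₂ / 2) from hh)]
        have h5 : (r / r₂) ^ (m + 1) ≤ (1 / 2 : ℝ) ^ (m + 1) := by
          apply pow_le_pow_left₀ (by positivity)
          rw [div_le_iff₀ hr2]
          linarith [not_lt.1 hh]
        rw [hbc] at hm
        have h6 := mul_le_mul_of_nonneg_left h5 (show 0 ≤ 2 * c + n by positivity)
        have := wp_pt c n (r ^ b) r _ (φ r) (ψ r) 0 hc0 (Real.rpow_nonneg hr0.le _) ht0 ht1
          (by linarith)
        linarith)
  rw [integral_sub' ((i1.const_mul (c / 2)).sub (i2.const_mul (2 / c))) (i3.const_mul (c + n)),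
    integral_sub' (i1.const_mul (c / 2)) (i2.const_mul (2 / c)),
    integral_const_mul, integral_const_mul, integral_const_mul] at key
  have p2 : 0 ≤ ∫ r in Set.Ioo r₁ r₂, r ^ (b + 2) * (ψ r) ^ 2 :=
    setIntegral_nonneg measurableSet_Ioo fun r hr =>
      mul_nonneg (Real.rpow_nonneg (h0.trans hr.1).le _) (sq_nonneg _)
  have p3 : 0 ≤ ∫ r in Set.Ioo r₁ r₂,
      (Set.Ioi (r₂ / 2)).indicator (fun r => r ^ b * (φ r) ^ 2) r :=
    setIntegral_nonneg measurableSet_Ioo fun r hr =>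
      Set.indicator_apply_nonneg fun _ =>
        mul_nonneg (Real.rpow_nonneg (h0.trans hr.1).le _) (sq_nonneg _)
  generalize (∫ r in Set.Ioo r₁ r₂, r ^ b * (φ r) ^ 2) = A at *
  generalize (∫ r in Set.Ioo r₁ r₂, r ^ (b + 2) * (ψ r) ^ 2) = B at *
  generalize (∫ r in Set.Ioo r₁ r₂,
      (Set.Ioi (r₂ / 2)).indicator (fun r => r ^ b * (φ r) ^ 2) r) = E at *
  have hA : A = 2 / c * (c / 2 * A) := by field_simp
  rw [hA, mul_assoc (2 / c)]
  apply mul_le_mul_of_nonneg_left _ (by positivity)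
  have h7 : 0 ≤ 2 / c * E := by positivity
  have h8 : 0 ≤ (c + n) * B := by positivity
  nlinarith
end

section
/- Let M > 0, a ∈ (0, 1), b ∈ (−1, 0), and C₀ ≥ 0. Let f : (M, ∞) → ℝ be continuous with |f(r)| ≤ C₀ r^{−a−2} ((r − M)/r)^b for all r > M. Then there exists a unique C¹ function φ : (M, ∞) → ℝ such that r ↦ (r − M)² φ'(r) is C¹ with ((r − M)² φ'(r))' = r² f(r) for all r > M, and such that sup_{r > M} |φ(r)| · r^{a} ((r − M)/r)^{−b} < ∞. Moreover there is a constant C₁, depending only on M, a, b and C₀, with |φ(r)| ≤ C₁ r^{−a} ((r − M)/r)^b for all r > M. -/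
/-- `φ` is a solution of the spherically symmetric zero-frequency extremal
Reissner–Nordström equation `((r − M)²φ')' = r²f` on `(M, ∞)` which is
bounded in the weighted space with decay rate `a` at infinity and `−b` at the
horizon. -/
def IsZeroFreqSol (M a b : ℝ) (f φ : ℝ → ℝ) : Prop :=
  ContDiffOn ℝ 1 φ (Set.Ioi M) ∧
  ContDiffOn ℝ 1 (fun r => (r - M) ^ 2 * deriv φ r) (Set.Ioi M) ∧
  (∀ r : ℝ, M < r → deriv (fun s => (s - M) ^ 2 * deriv φ s) r = r ^ 2 * f r) ∧
  ∃ K : ℝ, ∀ r : ℝ, M < r → |φ r| * r ^ a * ((r - M) / r) ^ (-b) ≤ K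

open Set Filter Topology MeasureTheory

lemma zf_primA {M : ℝ} {h H H' : ℝ → ℝ} (hc : ContinuousOn h (Ioi M))
    (Hc : ContinuousOn H (Ici M)) (H0 : H M = 0)
    (Hd : ∀ r, M < r → HasDerivAt H (H' r) r)
    (hb : ∀ r, M < r → |h r| ≤ H' r) :
    ∃ G : ℝ → ℝ, ∀ r, M < r → HasDerivAt G (h r) r ∧ |G r| ≤ H r := by
  have Hi : ∀ r, M < r → IntegrableOn H' (Ioc M r) := fun r hr =>
    intervalIntegral.integrableOn_deriv_of_nonneg (Hc.mono Icc_subset_Ici_self)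
      (fun x hx => Hd x hx.1) (fun x hx => (abs_nonneg _).trans (hb x hx.1))
  have hi : ∀ r, M < r → IntervalIntegrable h volume M r := by
    intro r hr
    rw [intervalIntegrable_iff_integrableOn_Ioc_of_le hr.le]
    refine Integrable.mono' (Hi r hr)
      ((hc.mono Ioc_subset_Ioi_self).aestronglyMeasurable measurableSet_Ioc) ?_
    filter_upwards [ae_restrict_mem measurableSet_Ioc] with x hx using hb x hx.1
  refine ⟨fun r => ∫ s in M..r, h s, fun r hr => ⟨?_, ?_⟩⟩
  · exact intervalIntegral.integral_hasDerivAt_right (hi r hr)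
      (hc.stronglyMeasurableAtFilter isOpen_Ioi _ hr) (hc.continuousAt (Ioi_mem_nhds hr))
  · have hI : IntervalIntegrable H' volume M r := by
      rw [intervalIntegrable_iff_integrableOn_Ioc_of_le hr.le]; exact Hi r hr
    have h1 := intervalIntegral.norm_integral_le_of_norm_le (f := h) hr.le
      (Eventually.of_forall fun t ht => hb t ht.1) hI
    rw [intervalIntegral.integral_eq_sub_of_hasDerivAt_of_le hr.le
      (Hc.mono Icc_subset_Ici_self) (fun x hx => Hd x hx.1) hI, H0, sub_zero] at h1
    exact h1

lemma zf_primB {M : ℝ} {g P P' : ℝ → ℝ} (hc : ContinuousOn g (Ioi M))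
    (P0 : Tendsto P atTop (𝓝 0))
    (Pd : ∀ r, M < r → HasDerivAt P (P' r) r)
    (hb : ∀ r, M < r → |g r| ≤ - P' r) :
    ∃ F : ℝ → ℝ, ∀ r, M < r → HasDerivAt F (g r) r ∧ |F r| ≤ P r := by
  have hn : ∀ r, M < r → P' r ≤ 0 := fun r hr => by
    have := (abs_nonneg _).trans (hb r hr); linarith
  have Pint : ∀ r, M < r → IntegrableOn P' (Ioi r) := fun r hr =>
    integrableOn_Ioi_deriv_of_nonpos' (fun x hx => Pd x (hr.trans_le hx))
      (fun x hx => hn x (hr.trans hx)) P0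
  have gi : ∀ r, M < r → IntegrableOn g (Ioi r) := by
    intro r hr
    refine Integrable.mono' (Pint r hr).neg
      ((hc.mono (Ioi_subset_Ioi hr.le)).aestronglyMeasurable measurableSet_Ioi) ?_
    filter_upwards [ae_restrict_mem measurableSet_Ioi] with x hx using hb x (hr.trans hx)
  refine ⟨fun r => - ∫ s in Ioi r, g s, fun r hr => ⟨?_, ?_⟩⟩
  · have h1 : HasDerivAt (fun u => (∫ s in r..u, g s) - ∫ s in Ioi r, g s) (g r) r :=
      (intervalIntegral.integral_hasDerivAt_right (by simp)
      (hc.stronglyMeasurableAtFilter isOpen_Ioi _ hr)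
      (hc.continuousAt (Ioi_mem_nhds hr))).sub_const _
    refine h1.congr_of_eventuallyEq ?_
    filter_upwards [Ioi_mem_nhds hr] with u hu
    rw [← intervalIntegral.integral_Ioi_sub_Ioi' (gi r hr) (gi u hu)]; ring
  · have h1 := norm_integral_le_of_norm_le (f := g) (Pint r hr).neg (by
      filter_upwards [ae_restrict_mem measurableSet_Ioi] with x hx using hb x (hr.trans hx))
    simp only [Pi.neg_apply] at h1
    rw [integral_neg, integral_Ioi_of_hasDerivAt_of_nonpos'
      (fun x hx => Pd x (hr.trans_le hx)) (fun x hx => hn x (hr.trans hx)) P0] at h1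
    simpa using h1

lemma zf_contDiff {M : ℝ} {F g : ℝ → ℝ} (hg : ContinuousOn g (Ioi M))
    (hF : ∀ r, M < r → HasDerivAt F (g r) r) : ContDiffOn ℝ 1 F (Ioi M) := by
  rw [show (1 : WithTop ℕ∞) = 0 + 1 by simp, contDiffOn_succ_iff_deriv_of_isOpen isOpen_Ioi]
  refine ⟨fun r hr => (hF r hr).differentiableAt.differentiableWithinAt, by simp, ?_⟩
  rw [contDiffOn_zero]
  exact hg.congr fun r hr => (hF r hr).deriv

lemma zf_pow {M p q r : ℝ} (hM : 0 < M) (hr : M < r) :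
    HasDerivAt (fun s => (s - M) ^ p * s ^ q)
      ((r - M) ^ (p - 1) * r ^ (q - 1) * (p * r + q * (r - M))) r := by
  have hx : 0 < r - M := by linarith
  have h0 : 0 < r := by linarith
  have h1 := (((hasDerivAt_id r).sub_const M).rpow_const (p := p) (Or.inl hx.ne')).mul
    ((hasDerivAt_id r).rpow_const (p := q) (Or.inl h0.ne'))
  refine h1.congr_deriv ?_
  simp only [id]
  rw [Real.rpow_sub_one hx.ne', Real.rpow_sub_one h0.ne']
  field_simp

lemma zf_weight {M a b r : ℝ} (hM : 0 < M) (hr : M < r) :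
    r ^ (-a) * ((r - M) / r) ^ b = (r - M) ^ b * r ^ (-a - b) := by
  have hx : 0 < r - M := by linarith
  have h0 : 0 < r := by linarith
  rw [Real.div_rpow hx.le h0.le, Real.rpow_sub h0]; ring

lemma zf_P_tendsto {M a b : ℝ} (hM : 0 < M) (ha : 0 < a) :
    Tendsto (fun r : ℝ => (r - M) ^ b * r ^ (-a - b)) atTop (𝓝 0) := by
  have h1 : Tendsto (fun r : ℝ => (r - M) / r) atTop (𝓝 1) := by
    have : Tendsto (fun r : ℝ => 1 - M / r) atTop (𝓝 (1 - 0)) :=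
      tendsto_const_nhds.sub (tendsto_const_nhds.div_atTop tendsto_id)
    rw [sub_zero] at this
    refine this.congr' ?_
    filter_upwards [eventually_gt_atTop 0] with r hr
    field_simp
  have h2 := (tendsto_rpow_neg_atTop ha).mul (h1.rpow_const (p := b) (Or.inl one_ne_zero))
  rw [zero_mul] at h2
  refine h2.congr' ?_
  filter_upwards [eventually_gt_atTop M] with r hr using zf_weight hM hr

lemma zf_const {M : ℝ} {u : ℝ → ℝ} (hu : ∀ r, M < r → HasDerivAt u 0 r) :
    ∃ c, ∀ r, M < r → u r = c := by
  obtain ⟨c, hc⟩ := isOpen_Ioi.exists_is_const_of_deriv_eq_zero (s := Ioi M) (f := u)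
    isPreconnected_Ioi
    (fun r hr => (hu r hr).differentiableAt.differentiableWithinAt)
    (fun r hr => (hu r hr).deriv)
  exact ⟨c, hc⟩

lemma zf_bound {M a b K r y : ℝ} (hM : 0 < M) (hr : M < r)
    (h : |y| * r ^ a * ((r - M) / r) ^ (-b) ≤ K) :
    |y| ≤ K * ((r - M) ^ b * r ^ (-a - b)) := by
  have hx : 0 < r - M := by linarith
  have h0 : 0 < r := by linarith
  rw [← zf_weight hM hr]
  have e : 0 < r ^ (-a) * ((r - M) / r) ^ b := by positivity
  have := mul_le_mul_of_nonneg_right h e.le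
  refine le_trans (le_of_eq ?_) this
  have e1 : r ^ a * r ^ (-a) = 1 := by rw [← Real.rpow_add h0]; simp
  have e2 : ((r - M) / r) ^ (-b) * ((r - M) / r) ^ b = 1 := by
    rw [← Real.rpow_add (by positivity)]; simp
  calc |y| = |y| * (r ^ a * r ^ (-a)) * (((r - M) / r) ^ (-b) * ((r - M) / r) ^ b) := by
        rw [e1, e2]; ring
    _ = _ := by ring

lemma zf_unique {M a b : ℝ} (hM : 0 < M) (ha : 0 < a) (hb : -1 < b) {f φ ψ : ℝ → ℝ}
    (h1 : IsZeroFreqSol M a b f φ) (h2 : IsZeroFreqSol M a b f ψ) :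
    ∀ r, M < r → ψ r = φ r := by
  obtain ⟨p1, p2, p3, K, p4⟩ := h1
  obtain ⟨q1, q2, q3, L, q4⟩ := h2
  have D1 : ∀ {w : ℝ → ℝ}, ContDiffOn ℝ 1 w (Ioi M) → ∀ r, M < r →
      HasDerivAt w (deriv w r) r := fun hw r hr =>
    ((hw.differentiableOn (by simp)).differentiableAt (Ioi_mem_nhds hr)).hasDerivAt
  obtain ⟨c, hc⟩ := zf_const (M := M)
    (u := fun r => (r - M) ^ 2 * deriv ψ r - (r - M) ^ 2 * deriv φ r) (fun r hr => by
      have := (D1 q2 r hr).sub (D1 p2 r hr)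
      rw [q3 r hr, p3 r hr, sub_self] at this
      exact this)
  obtain ⟨d, hd⟩ := zf_const (M := M)
    (u := fun r => ψ r - φ r + c * (r - M)⁻¹) (fun r hr => by
      have hx : r - M ≠ 0 := by linarith
      have := ((D1 q1 r hr).sub (D1 p1 r hr)).add
        ((((hasDerivAt_id r).sub_const M).inv hx).const_mul c)
      refine this.congr_deriv ?_
      rw [← hc r hr]; simp only [id]; field_simp; ring)
  have hB : ∀ r, M < r → |ψ r - φ r| ≤ (L + K) * ((r - M) ^ b * r ^ (-a - b)) := by
    intro r hr
    have e1 := zf_bound hM hr (p4 r hr)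
    have e2 := zf_bound hM hr (q4 r hr)
    have := abs_sub (ψ r) (φ r)
    linarith
  have hd0 : d = 0 := by
    have t1 : Tendsto (fun r => ψ r - φ r) atTop (𝓝 0) := by
      refine squeeze_zero_norm' (a := fun r => (L + K) * ((r - M) ^ b * r ^ (-a - b))) ?_ ?_
      · filter_upwards [eventually_gt_atTop M] with r hr using hB r hr
      · simpa using (zf_P_tendsto (b := b) hM ha).const_mul (L + K)
    have t2 : Tendsto (fun r : ℝ => c * (r - M)⁻¹) atTop (𝓝 0) := by
      have : Tendsto (fun r : ℝ => r - M) atTop atTop := tendsto_atTop_add_const_right _ _ tendsto_id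
      simpa using this.inv_tendsto_atTop.const_mul c
    have t3 := t1.add t2
    rw [add_zero] at t3
    refine tendsto_nhds_unique (tendsto_const_nhds.congr' ?_) t3
    filter_upwards [eventually_gt_atTop M] with r hr using (hd r hr).symm
  have hc0 : c = 0 := by
    have hcb : ∀ r, M < r → ‖c‖ ≤ (L + K) * ((r - M) ^ (b + 1) * r ^ (-a - b)) := by
      intro r hr
      have hx : 0 < r - M := by linarith
      have e := hd r hr
      have e' : c = - (ψ r - φ r) * (r - M) := by
        rw [hd0] at e
        have : ψ r - φ r = - (c * (r - M)⁻¹) := by simpa using eq_neg_of_add_eq_zero_left e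
        rw [this]; field_simp
      rw [e', Real.norm_eq_abs, abs_mul, abs_neg, abs_of_pos hx, Real.rpow_add_one hx.ne']
      have := mul_le_mul_of_nonneg_right (hB r hr) hx.le
      linarith
    have t : Tendsto (fun r : ℝ => (L + K) * ((r - M) ^ (b + 1) * r ^ (-a - b))) (𝓝[>] M) (𝓝 0) := by
      have : ContinuousAt (fun r : ℝ => (L + K) * ((r - M) ^ (b + 1) * r ^ (-a - b))) M := by
        refine continuousAt_const.mul (ContinuousAt.mul ?_ ?_)
        · exact (continuousAt_id.sub continuousAt_const).rpow_const (Or.inr (by linarith))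
        · exact continuousAt_id.rpow_const (Or.inl hM.ne')
      have h := this.tendsto
      simp only [sub_self] at h
      rw [Real.zero_rpow (by linarith)] at h
      simp only [zero_mul, mul_zero] at h
      exact h.mono_left nhdsWithin_le_nhds
    have : ‖c‖ ≤ 0 := ge_of_tendsto t (by
      filter_upwards [self_mem_nhdsWithin] with r hr using hcb r hr)
    simpa using this
  intro r hr
  have := hd r hr
  rw [hc0, hd0] at this
  linarith

/-- Invertibility of the spherically symmetric zero-frequency operator between
weighted spaces: for `M > 0`, `a ∈ (0, 1)`, `b ∈ (−1, 0)`, `C₀ ≥ 0` and any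
continuous `f` on `(M, ∞)` with `|f(r)| ≤ C₀ r^(−a−2) ((r − M)/r)^b`, there is
a unique `C¹` function `φ` on `(M, ∞)` with `(r − M)²φ'` of class `C¹`,
`((r − M)²φ')' = r²f`, and finite weighted sup-norm; moreover
`|φ(r)| ≤ C₁ r^(−a) ((r − M)/r)^b` with `C₁` depending only on
`M, a, b, C₀`. -/
theorem zero_frequency_invertibility (M a b C₀ : ℝ) (hM : 0 < M)
    (ha : 0 < a) (ha' : a < 1) (hb : -1 < b) (hb' : b < 0) (hC₀ : 0 ≤ C₀) :
    ∃ C₁ : ℝ, ∀ f : ℝ → ℝ, ContinuousOn f (Set.Ioi M) →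
      (∀ r : ℝ, M < r → |f r| ≤ C₀ * r ^ (-a - 2) * ((r - M) / r) ^ b) →
      ∃ φ : ℝ → ℝ, IsZeroFreqSol M a b f φ ∧
        (∀ r : ℝ, M < r → |φ r| ≤ C₁ * r ^ (-a) * ((r - M) / r) ^ b) ∧
        ∀ ψ : ℝ → ℝ, IsZeroFreqSol M a b f ψ → ∀ r : ℝ, M < r → ψ r = φ r := by

  set c1 := min (b + 1) (1 - a) with hc1
  set c2 := min (-b) a with hc2
  have c1p : 0 < c1 := lt_min (by linarith) (by linarith)
  have c2p : 0 < c2 := lt_min (by linarith) ha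
  have c1a : c1 ≤ b + 1 := min_le_left _ _
  have c1b : c1 ≤ 1 - a := min_le_right _ _
  have c2a : c2 ≤ -b := min_le_left _ _
  have c2b : c2 ≤ a := min_le_right _ _
  refine ⟨C₀ / c1 / c2, fun f hf hfb => ?_⟩
  obtain ⟨G, hG⟩ := zf_primA (M := M) (h := fun r => r ^ 2 * f r)
    (H := fun r => C₀ / c1 * ((r - M) ^ (b + 1) * r ^ (-a - b)))
    (H' := fun r => C₀ / c1 * ((r - M) ^ (b + 1 - 1) * r ^ (-a - b - 1) *
      ((b + 1) * r + (-a - b) * (r - M))))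
    ((continuousOn_id.pow 2).mul hf)
    (by
      refine continuousOn_const.mul (ContinuousOn.mul ?_ ?_)
      · exact (continuousOn_id.sub continuousOn_const).rpow_const
          (fun x _ => Or.inr (by linarith))
      · exact continuousOn_id.rpow_const
          (fun x hx => Or.inl (hM.trans_le hx).ne'))
    (by simp [Real.zero_rpow (show b + 1 ≠ 0 by linarith)])
    (fun r hr => (zf_pow hM hr).const_mul _)
    (by
      intro r hr
      have hx : 0 < r - M := by linarith
      have h0 : 0 < r := by linarith
      have e1 : r ^ 2 * (C₀ * r ^ (-a - 2) * ((r - M) / r) ^ b)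
          = C₀ * ((r - M) ^ b * r ^ (-a - b)) := by
        rw [← zf_weight hM hr, Real.rpow_sub h0 (-a) 2, Real.rpow_two]; field_simp
      rw [abs_mul, abs_of_pos (by positivity : 0 < r ^ 2)]
      refine (mul_le_mul_of_nonneg_left (hfb r hr) (by positivity)).trans ?_
      rw [e1, add_sub_cancel_right, Real.rpow_sub_one h0.ne']
      have k : c1 * r ≤ (b + 1) * r + (-a - b) * (r - M) := by nlinarith
      calc C₀ * ((r - M) ^ b * r ^ (-a - b))
          = C₀ / c1 * ((r - M) ^ b * (r ^ (-a - b) / r) * (c1 * r)) := by field_simp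
        _ ≤ _ := by gcongr)
  have Gc : ContinuousOn G (Set.Ioi M) := fun r hr =>
    (hG r hr).1.continuousAt.continuousWithinAt
  have gc : ContinuousOn (fun r => G r / (r - M) ^ 2) (Set.Ioi M) :=
    Gc.div ((continuousOn_id.sub continuousOn_const).pow 2) (fun r hr => by
      have : 0 < r - M := sub_pos.2 hr
      positivity)
  obtain ⟨φ, hφ⟩ := zf_primB (M := M) (g := fun r => G r / (r - M) ^ 2)
    (P := fun r => C₀ / c1 / c2 * ((r - M) ^ b * r ^ (-a - b)))
    (P' := fun r => C₀ / c1 / c2 * ((r - M) ^ (b - 1) * r ^ (-a - b - 1) *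
      (b * r + (-a - b) * (r - M)))) gc
    (by simpa using (zf_P_tendsto (b := b) hM ha).const_mul (C₀ / c1 / c2))
    (fun r hr => (zf_pow hM hr).const_mul _)
    (by
      intro r hr
      have hx : 0 < r - M := by linarith
      have h0 : 0 < r := by linarith
      rw [abs_div, abs_of_pos (by positivity : 0 < (r - M) ^ 2), div_le_iff₀ (by positivity)]
      refine (hG r hr).2.trans ?_
      rw [Real.rpow_sub_one h0.ne', Real.rpow_sub_one hx.ne', Real.rpow_add_one hx.ne']
      have k : c2 * r ≤ -(b * r + (-a - b) * (r - M)) := by nlinarith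
      calc C₀ / c1 * ((r - M) ^ b * (r - M) * r ^ (-a - b))
          = C₀ / c1 / c2 * ((r - M) ^ b / (r - M) * (r ^ (-a - b) / r) * (c2 * r))
              * (r - M) ^ 2 := by field_simp
        _ ≤ C₀ / c1 / c2 * ((r - M) ^ b / (r - M) * (r ^ (-a - b) / r) *
              -(b * r + (-a - b) * (r - M))) * (r - M) ^ 2 := by gcongr
        _ = _ := by ring)
  have hE : Set.EqOn (fun r => (r - M) ^ 2 * deriv φ r) G (Set.Ioi M) := by
    intro r hr
    have hx : 0 < r - M := sub_pos.2 hr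
    simp only [(hφ r hr).1.deriv]
    field_simp
  have hbd : ∀ r : ℝ, M < r → |φ r| ≤ C₀ / c1 / c2 * r ^ (-a) * ((r - M) / r) ^ b := by
    intro r hr
    rw [mul_assoc, zf_weight hM hr]; exact (hφ r hr).2
  have hsol : IsZeroFreqSol M a b f φ := by
    refine ⟨zf_contDiff gc fun r hr => (hφ r hr).1, ?_, ?_, C₀ / c1 / c2, ?_⟩
    · exact (zf_contDiff ((continuousOn_id.pow 2).mul hf) fun r hr => (hG r hr).1).congr hE
    · intro r hr
      rw [(hE.eventuallyEq_of_mem (Ioi_mem_nhds hr)).deriv_eq]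
      exact (hG r hr).1.deriv
    · intro r hr
      have hx : 0 < r - M := by linarith
      have h0 : 0 < r := by linarith
      have e1 : r ^ (-a) * r ^ a = 1 := by rw [← Real.rpow_add h0]; simp
      have e2 : ((r - M) / r) ^ b * ((r - M) / r) ^ (-b) = 1 := by
        rw [← Real.rpow_add (by positivity)]; simp
      calc |φ r| * r ^ a * ((r - M) / r) ^ (-b)
          ≤ C₀ / c1 / c2 * r ^ (-a) * ((r - M) / r) ^ b * r ^ a * ((r - M) / r) ^ (-b) := by
            gcongr; exact hbd r hr
        _ = C₀ / c1 / c2 * (r ^ (-a) * r ^ a) * (((r - M) / r) ^ b * ((r - M) / r) ^ (-b)) := by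
            ring
        _ = _ := by rw [e1, e2]; ring
  exact ⟨φ, hsol, hbd, fun ψ hψ => zf_unique hM ha hb hsol hψ⟩
end

section
/- Let a ≥ 0, b > −1, A ≥ 0, and let f be a continuous function on Q = {(u, v) ∈ ℝ² : 0 < u ≤ v} satisfying |f(u, v)| ≤ A u^{−a} v^{−b} on Q. For (u, v) ∈ Q define h(u, v) = −∫_v^∞ v'^{−2} f(u'(v'), v') dv', where u'(v') > 0 is determined by 1/u' − 1/v' = 1/u − 1/v. Then the integral converges absolutely, |h(u, v)| ≤ A u^{−a} v^{−b−1}/(b + 1) on Q, and for every integral curve γ of the vector field u²∂_u + v²∂_v contained in Q, the function s ↦ h(γ(s)) is differentiable with (d/ds) h(γ(s)) = f(γ(s)). In other words, integrating backwards along the flow of the conformal scaling field 𝒯 = u²∂_u + v²∂_v solves 𝒯h = f with a gain of one power of decay in v. -/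
open MeasureTheory

/-- Backwards integration along the flow of the conformal scaling field
`𝒯 = u²∂_u + v²∂_v`:
`h(u, v) = −∫_v^∞ v'⁻² f(u'(v'), v') dv'`, where `u'(v')` is determined by
`1/u' − 1/v' = 1/u − 1/v`. -/
noncomputable def Tinv (f : ℝ → ℝ → ℝ) (u v : ℝ) : ℝ :=
  -∫ v' in Set.Ioi v, (v' ^ 2)⁻¹ * f ((1 / u - 1 / v + 1 / v')⁻¹) v'

lemma cf_u_bounds {c v w : ℝ} (hc : 0 ≤ c) (hv : 0 < v) (hw : v ≤ w) :
    0 < (c + 1 / v)⁻¹ ∧ (c + 1 / v)⁻¹ ≤ (c + 1 / w)⁻¹ ∧ (c + 1 / w)⁻¹ ≤ w := by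
  have hw0 : 0 < w := lt_of_lt_of_le hv hw
  have h1 : 0 < 1 / v := by positivity
  have h2 : 0 < 1 / w := by positivity
  have h3 : 1 / w ≤ 1 / v := one_div_le_one_div_of_le hv hw
  refine ⟨by positivity, ?_, ?_⟩
  · exact inv_anti₀ (by positivity) (by linarith)
  · have : (c + 1 / w)⁻¹ ≤ (1 / w)⁻¹ := inv_anti₀ h2 (by linarith)
    simpa using this

lemma cf_cont {f : ℝ → ℝ → ℝ} {c : ℝ} (hc : 0 ≤ c)
    (hf : ContinuousOn (Function.uncurry f) {p : ℝ × ℝ | 0 < p.1 ∧ p.1 ≤ p.2}) :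
    ContinuousOn (fun v' => (v' ^ 2)⁻¹ * f ((c + 1 / v')⁻¹) v') (Set.Ioi 0) := by
  have h1 : ContinuousOn (fun v' : ℝ => ((c + 1 / v')⁻¹, v')) (Set.Ioi 0) := by
    refine ContinuousOn.prodMk (ContinuousOn.inv₀ ?_ ?_) continuousOn_id
    · exact continuousOn_const.add
        (continuousOn_const.div continuousOn_id (fun x hx => ne_of_gt hx))
    · intro x hx
      have : 0 < 1 / x := one_div_pos.mpr hx
      positivity
  have h2 := hf.comp h1 (fun x hx =>
    ⟨(cf_u_bounds hc hx le_rfl).1, (cf_u_bounds hc hx le_rfl).2.2⟩)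
  refine ContinuousOn.mul (ContinuousOn.inv₀ (continuousOn_id.pow 2) ?_) h2
  intro x hx
  exact pow_ne_zero 2 (ne_of_gt hx)

lemma cf_bd {a b A : ℝ} (ha : 0 ≤ a) (hA : 0 ≤ A) {f : ℝ → ℝ → ℝ}
    (hbound : ∀ u v : ℝ, 0 < u → u ≤ v → |f u v| ≤ A * u ^ (-a) * v ^ (-b))
    {c v w : ℝ} (hc : 0 ≤ c) (hv : 0 < v) (hw : v ≤ w) :
    ‖(w ^ 2)⁻¹ * f ((c + 1 / w)⁻¹) w‖ ≤ A * ((c + 1 / v)⁻¹) ^ (-a) * w ^ (-b - 2) := by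
  obtain ⟨h1, h2, h3⟩ := cf_u_bounds hc hv hw
  have hw0 : 0 < w := lt_of_lt_of_le hv hw
  have h4 := hbound _ w (lt_of_lt_of_le h1 h2) h3
  have h5 : ((c + 1 / w)⁻¹) ^ (-a) ≤ ((c + 1 / v)⁻¹) ^ (-a) :=
    Real.rpow_le_rpow_of_nonpos h1 h2 (by linarith)
  have h6 : w ^ (-b - 2) = (w ^ 2)⁻¹ * w ^ (-b) := by
    rw [Real.rpow_sub hw0, div_eq_inv_mul]
    norm_num
  have h7 : 0 < w ^ (-b) := Real.rpow_pos_of_pos hw0 _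
  rw [norm_mul, Real.norm_eq_abs, Real.norm_eq_abs, abs_of_pos (by positivity), h6]
  calc (w ^ 2)⁻¹ * |f ((c + 1 / w)⁻¹) w|
      ≤ (w ^ 2)⁻¹ * (A * ((c + 1 / v)⁻¹) ^ (-a) * w ^ (-b)) := by
        gcongr
        exact h4.trans (by gcongr)
    _ = _ := by ring

lemma cf_int {a b A : ℝ} (ha : 0 ≤ a) (hb : -1 < b) (hA : 0 ≤ A) {f : ℝ → ℝ → ℝ}
    (hf : ContinuousOn (Function.uncurry f) {p : ℝ × ℝ | 0 < p.1 ∧ p.1 ≤ p.2})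
    (hbound : ∀ u v : ℝ, 0 < u → u ≤ v → |f u v| ≤ A * u ^ (-a) * v ^ (-b))
    {c v : ℝ} (hc : 0 ≤ c) (hv : 0 < v) :
    IntegrableOn (fun v' => (v' ^ 2)⁻¹ * f ((c + 1 / v')⁻¹) v') (Set.Ioi v) ∧
    |∫ v' in Set.Ioi v, (v' ^ 2)⁻¹ * f ((c + 1 / v')⁻¹) v'| ≤
      A * ((c + 1 / v)⁻¹) ^ (-a) * v ^ (-b - 1) / (b + 1) := by
  have hi : IntegrableOn (fun w : ℝ => A * ((c + 1 / v)⁻¹) ^ (-a) * w ^ (-b - 2)) (Set.Ioi v) :=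
    (integrableOn_Ioi_rpow_of_lt (by linarith) hv).const_mul _
  have hae : ∀ᵐ w ∂(volume.restrict (Set.Ioi v)), ‖(w ^ 2)⁻¹ * f ((c + 1 / w)⁻¹) w‖ ≤
      A * ((c + 1 / v)⁻¹) ^ (-a) * w ^ (-b - 2) :=
    (ae_restrict_iff' measurableSet_Ioi).2
      (Filter.Eventually.of_forall fun w hw => cf_bd ha hA hbound hc hv (le_of_lt hw))
  refine ⟨Integrable.mono' hi ?_ hae, ?_⟩
  · exact ((cf_cont hc hf).mono (Set.Ioi_subset_Ioi hv.le)).aestronglyMeasurable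
      measurableSet_Ioi
  · refine (norm_integral_le_of_norm_le hi hae).trans (le_of_eq ?_)
    rw [integral_const_mul, integral_Ioi_rpow_of_lt (by linarith) hv]
    have e : -b - 2 + 1 = -(b + 1) := by ring
    have e' : -b - 1 = -(b + 1) := by ring
    rw [e, e', neg_div_neg_eq, mul_div_assoc]

lemma cf_uv {u v : ℝ} (hu : 0 < u) (huv : u ≤ v) :
    0 ≤ 1 / u - 1 / v ∧ (1 / u - 1 / v + 1 / v)⁻¹ = u :=
  ⟨sub_nonneg.2 (one_div_le_one_div_of_le hu huv), by simp⟩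

/-- Let `a ≥ 0`, `b > −1`, `A ≥ 0` and let `f` be continuous on
`Q = {0 < u ≤ v}` with `|f(u, v)| ≤ A u^(−a) v^(−b)` on `Q`.  Then the
integral defining `h = Tinv f` converges absolutely, satisfies
`|h(u, v)| ≤ A u^(−a) v^(−b−1)/(b + 1)` on `Q`, and along every integral curve
`γ` of the vector field `u²∂_u + v²∂_v` contained in `Q` one has
`(d/ds) h(γ(s)) = f(γ(s))`: backwards integration along the conformal flow
solves `𝒯h = f` with a gain of one power of decay in `v`. -/
theorem conformal_flow_backwards_integration (a b A : ℝ)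
    (ha : 0 ≤ a) (hb : -1 < b) (hA : 0 ≤ A) (f : ℝ → ℝ → ℝ)
    (hf : ContinuousOn (Function.uncurry f) {p : ℝ × ℝ | 0 < p.1 ∧ p.1 ≤ p.2})
    (hbound : ∀ u v : ℝ, 0 < u → u ≤ v → |f u v| ≤ A * u ^ (-a) * v ^ (-b)) :
    (∀ u v : ℝ, 0 < u → u ≤ v →
      IntegrableOn (fun v' => (v' ^ 2)⁻¹ * f ((1 / u - 1 / v + 1 / v')⁻¹) v')
        (Set.Ioi v)) ∧
    (∀ u v : ℝ, 0 < u → u ≤ v →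
      |Tinv f u v| ≤ A * u ^ (-a) * v ^ (-b - 1) / (b + 1)) ∧
    (∀ (γ : ℝ → ℝ × ℝ) (S : Set ℝ) (s₀ : ℝ), IsOpen S → s₀ ∈ S →
      (∀ s ∈ S, 0 < (γ s).1 ∧ (γ s).1 ≤ (γ s).2) →
      (∀ s ∈ S, HasDerivAt (fun s' => (γ s').1) ((γ s).1 ^ 2) s) →
      (∀ s ∈ S, HasDerivAt (fun s' => (γ s').2) ((γ s).2 ^ 2) s) →
      HasDerivAt (fun s => Tinv f (γ s).1 (γ s).2) (f (γ s₀).1 (γ s₀).2) s₀) := by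
  refine ⟨?_, ?_, ?_⟩
  · intro u v hu huv
    exact (cf_int ha hb hA hf hbound (cf_uv hu huv).1 (hu.trans_le huv)).1
  · intro u v hu huv
    have := (cf_int ha hb hA hf hbound (cf_uv hu huv).1 (hu.trans_le huv)).2
    rw [(cf_uv hu huv).2] at this
    rwa [Tinv, abs_neg]
  · intro γ S s₀ hS hs₀ hQ h1 h2
    obtain ⟨ε, hε, hball⟩ := Metric.isOpen_iff.1 hS s₀ hs₀
    have hv0 : ∀ s ∈ S, 0 < (γ s).2 := fun s hs => (hQ s hs).1.trans_le (hQ s hs).2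
    have hd : ∀ s ∈ S, HasDerivAt (fun s => 1 / (γ s).1 - 1 / (γ s).2) 0 s := by
      intro s hs
      have hu := (hQ s hs).1.ne'
      have hv := (hv0 s hs).ne'
      have := ((h1 s hs).inv hu).sub ((h2 s hs).inv hv)
      simp only [one_div]
      refine HasDerivAt.congr_deriv this ?_
      rw [neg_div, neg_div, div_self (pow_ne_zero 2 hu), div_self (pow_ne_zero 2 hv)]
      ring
    obtain ⟨c, hc⟩ : ∃ c, c = 1 / (γ s₀).1 - 1 / (γ s₀).2 := ⟨_, rfl⟩
    have hc0 : 0 ≤ c := hc ▸ (cf_uv (hQ s₀ hs₀).1 (hQ s₀ hs₀).2).1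
    have hconst : ∀ s ∈ Metric.ball s₀ ε, 1 / (γ s).1 - 1 / (γ s).2 = c := by
      intro s hs
      rw [hc]
      exact Metric.isOpen_ball.is_const_of_deriv_eq_zero
        (convex_ball s₀ ε).isPreconnected
        (fun x hx => (hd x (hball hx)).differentiableAt.differentiableWithinAt)
        (fun x hx => (hd x (hball hx)).deriv) hs (Metric.mem_ball_self hε)
    have hV := hv0 s₀ hs₀
    have hcont := cf_cont hc0 hf
    obtain ⟨g, hg⟩ : ∃ g : ℝ → ℝ, g = fun v' => (v' ^ 2)⁻¹ * f ((c + 1 / v')⁻¹) v' := ⟨_, rfl⟩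
    have hint : ∀ v, 0 < v → IntegrableOn g (Set.Ioi v) := fun v hv =>
      hg ▸ (cf_int ha hb hA hf hbound hc0 hv).1
    rw [← hg] at hcont
    have hG : HasDerivAt (fun v => ∫ x in (γ s₀).2..v, g x) (g (γ s₀).2) (γ s₀).2 :=
      intervalIntegral.integral_hasDerivAt_right (by simp)
        (hcont.stronglyMeasurableAtFilter isOpen_Ioi _ hV)
        (hcont.continuousAt (Ioi_mem_nhds hV))
    have hG2 := (hG.comp s₀ (h2 s₀ hs₀)).sub_const (∫ x in Set.Ioi (γ s₀).2, g x)
    have hval : g (γ s₀).2 * (γ s₀).2 ^ 2 = f (γ s₀).1 (γ s₀).2 := by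
      rw [hg]
      simp only
      rw [hc, (cf_uv (hQ s₀ hs₀).1 (hQ s₀ hs₀).2).2]
      field_simp
    rw [hval] at hG2
    refine hG2.congr_of_eventuallyEq ?_
    filter_upwards [Metric.ball_mem_nhds s₀ hε] with s hs
    have := intervalIntegral.integral_interval_add_Ioi (hint _ hV) (hint _ (hv0 s (hball hs)))
    rw [Tinv, hconst s hs, ← hg]
    simp only [Function.comp]
    linarith
end

section
/- Let M > 0, ε ∈ (0, M), and let φ : ℝ × (M − ε, ∞) → ℝ be C², with coordinates (v, r). Suppose φ solves the spherically symmetric extremal Reissner–Nordström wave equation in ingoing coordinates: 2∂_v∂_r(rφ) + ∂_r(D(r) ∂_r(rφ)) − r⁻¹ D'(r) (rφ) = 0 on ℝ × (M − ε, ∞), where D(r) = (1 − M/r)². Then the Aretakis quantity v ↦ ∂_r(rφ)(v, M), i.e. the transversal derivative of rφ evaluated at the horizon r = M, is independent of v (a conserved charge along the event horizon). This uses that r = M is a double root of D, i.e. D(M) = D'(M) = 0 (extremality). -/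
/-- Conservation of the Aretakis charge on the extremal Reissner–Nordström
horizon: let `M > 0`, `ε ∈ (0, M)`, `D(r) = (1 − M/r)²`, `D'(r) = 2M(r − M)/r³`,
and let `φ = φ(v, r)` be `C²` on `ℝ × (M − ε, ∞)` solving the spherically
symmetric wave equation in ingoing coordinates
`2∂_v∂_r(rφ) + ∂_r(D(r)∂_r(rφ)) − r⁻¹D'(r)(rφ) = 0`.
Then the Aretakis quantity `v ↦ ∂_r(rφ)(v, M)` is independent of `v`. -/
theorem aretakis_charge_conserved (M ε : ℝ) (hM : 0 < M)
    (hε : 0 < ε) (hεM : ε < M) (φ : ℝ → ℝ → ℝ)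
    (hφ : ContDiffOn ℝ 2 (Function.uncurry φ)
      ((Set.univ : Set ℝ) ×ˢ Set.Ioi (M - ε)))
    (heq : ∀ v r : ℝ, M - ε < r →
      2 * deriv (fun v' => deriv (fun ρ => ρ * φ v' ρ) r) v
        + deriv (fun ρ => (1 - M / ρ) ^ 2 * deriv (fun ρ' => ρ' * φ v ρ') ρ) r
        - r⁻¹ * (2 * M * (r - M) / r ^ 3) * (r * φ v r) = 0) :
    ∀ v₁ v₂ : ℝ,
      deriv (fun ρ => ρ * φ v₁ ρ) M = deriv (fun ρ => ρ * φ v₂ ρ) M := by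
  have hUo : IsOpen ((Set.univ : Set ℝ) ×ˢ Set.Ioi (M - ε)) := isOpen_univ.prod isOpen_Ioi
  set U := (Set.univ : Set ℝ) ×ˢ Set.Ioi (M - ε) with hU
  set F : ℝ × ℝ → ℝ := fun p => p.2 * Function.uncurry φ p with hF
  have hFc : ContDiffOn ℝ 2 F U := contDiff_snd.contDiffOn.mul hφ
  have hmem : ∀ v r : ℝ, M - ε < r → (v, r) ∈ U := fun v r h => ⟨Set.mem_univ _, h⟩
  set G : ℝ × ℝ → ℝ := fun p => fderiv ℝ F p (0, 1) with hG
  have hGc : DifferentiableOn ℝ G U := by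
    have h1 : ContDiffOn ℝ 1 (fderiv ℝ F) U := hFc.fderiv_of_isOpen hUo (by norm_num)
    exact (h1.differentiableOn (by norm_num)).clm_apply (differentiableOn_const _)
  have hd : ∀ v r : ℝ, M - ε < r → deriv (fun ρ => ρ * φ v ρ) r = G (v, r) := by
    intro v r hr
    have h1 : DifferentiableAt ℝ F (v, r) :=
      (hFc.differentiableOn (by norm_num)).differentiableAt (hUo.mem_nhds (hmem v r hr))
    have h2 : HasDerivAt (fun ρ : ℝ => (v, ρ)) ((0 : ℝ), (1 : ℝ)) r :=
      (hasDerivAt_const r v).prodMk (hasDerivAt_id r)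
    exact (h1.hasFDerivAt.comp_hasDerivAt r h2).deriv
  have hMε : M - ε < M := by linarith
  have hGd : ∀ v : ℝ, DifferentiableAt ℝ G (v, M) := fun v =>
    hGc.differentiableAt (hUo.mem_nhds (hmem v M hMε))
  have hfun : (fun v' => deriv (fun ρ => ρ * φ v' ρ) M) = fun v' => G (v', M) :=
    funext fun v => hd v M hMε
  have hdiff : Differentiable ℝ (fun v' => deriv (fun ρ => ρ * φ v' ρ) M) := by
    rw [hfun]
    intro v
    have h2 : DifferentiableAt ℝ (fun x : ℝ => (x, M)) v := by fun_prop
    exact DifferentiableAt.comp (g := G) v (hGd v) h2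
  have hzero : ∀ v, deriv (fun v' => deriv (fun ρ => ρ * φ v' ρ) M) v = 0 := by
    intro v
    have h := heq v M hMε
    have hev : (fun ρ' => deriv (fun ρ => ρ * φ v ρ) ρ') =ᶠ[nhds M] fun ρ => G (v, ρ) := by
      filter_upwards [Ioi_mem_nhds hMε] with ρ hρ using hd v ρ hρ
    have hg : DifferentiableAt ℝ (fun ρ' => deriv (fun ρ => ρ * φ v ρ) ρ') M := by
      refine DifferentiableAt.congr_of_eventuallyEq ?_ hev
      have h2 : DifferentiableAt ℝ (fun x : ℝ => (v, x)) M := by fun_prop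
      exact DifferentiableAt.comp (g := G) M (hGd v) h2
    have hq : HasDerivAt (fun ρ : ℝ => (1 - M / ρ) ^ 2) 0 M := by
      have h3 : DifferentiableAt ℝ (fun ρ : ℝ => 1 - M / ρ) M := by
        fun_prop (disch := exact hM.ne')
      have h4 := h3.hasDerivAt.pow 2
      refine h4.congr_deriv ?_
      simp [hM.ne']
    have h5 := (hq.mul hg.hasDerivAt).deriv
    have h6 : deriv (fun ρ => (1 - M / ρ) ^ 2 * deriv (fun ρ' => ρ' * φ v ρ') ρ) M = 0 := by
      refine h5.trans ?_
      simp [hM.ne']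
    rw [h6] at h
    simpa using h
  exact fun v₁ v₂ => is_const_of_deriv_eq_zero hdiff hzero v₁ v₂
end
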